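/- arXiv:1806.06865 — 3 statements merged into one kernel-verified Lean document; each statement's English description precedes it below -/
import Mathlib

section
/- Let d ≥ 1 and let X = C(ℝ, ℝ^d) be the space of continuous functions from ℝ to ℝ^d with the compact-open topology, and let X₀ = {ω ∈ X : ω(0) = 0}. For t ∈ ℝ define the increment shift θ_t : X₀ → X₀ by (θ_t ω)(s) = ω(t+s) − ω(t), and the shift τ_t : X → X by (τ_t ω)(s) = ω(t+s). Let P be a Borel probability measure on X₀ which has stationary increments, i.e. the pushforward of P under θ_t equals P for every t ∈ ℝ, and which is ergodic, i.e. every Borel set A ⊆ X₀ satisfying θ_t^{-1}(A) = A for all t ∈ ℝ has P(A) ∈ {0,1}. Then at least one of the following holds: (i) for every continuous function V : ℝ^d → ℝ with compact support, lim_{ε→0⁺} ε ∫_{X₀} (∫_0^∞ e^{−εt} V(ω(t)) dt) dP(ω) = 0; or (ii) there exists a Borel probability measure Q on X which is invariant under τ_t for every t ∈ ℝ and whose pushforward under the map X → X₀, ω ↦ (s ↦ ω(s) − ω(0)), equals P. -/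
open MeasureTheory Filter Topology

/-- The path space `X = C(ℝ, ℝ^d)` with the compact-open topology. -/
abbrev PolaronPath (d : ℕ) := C(ℝ, EuclideanSpace ℝ (Fin d))

/-- The space `X₀` of continuous paths pinned at `0`. -/
abbrev PolaronPath₀ (d : ℕ) := {ω : PolaronPath d // ω 0 = 0}

/-- The shift `τ_t` on `X`: `(τ_t ω)(s) = ω(t+s)`. -/
noncomputable def polaronShift (d : ℕ) (t : ℝ) (ω : PolaronPath d) : PolaronPath d :=
  ⟨fun s => ω (t + s), ω.continuous.comp (continuous_const.add continuous_id)⟩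

/-- The increment shift `θ_t` on `X₀`: `(θ_t ω)(s) = ω(t+s) - ω(t)`. -/
noncomputable def polaronIncShift (d : ℕ) (t : ℝ) (ω : PolaronPath₀ d) : PolaronPath₀ d :=
  ⟨⟨fun s => ω.1 (t + s) - ω.1 t,
      (ω.1.continuous.comp (continuous_const.add continuous_id)).sub continuous_const⟩,
    by simp⟩

/-- The increment map `X → X₀`, `ω ↦ (s ↦ ω(s) - ω(0))`. -/
noncomputable def polaronInc (d : ℕ) (ω : PolaronPath d) : PolaronPath₀ d :=
  ⟨⟨fun s => ω s - ω 0, ω.continuous.sub continuous_const⟩, by simp⟩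

/-- For a measurable flow whose strictly invariant sets are trivial, sets that are almost
everywhere invariant under every time shift are trivial as well. -/
theorem ae_mem_or_ae_notMem_of_forall_preimage_ae_eq {Ω : Type*} [MeasurableSpace Ω]
    {θ : ℝ → Ω → Ω} (hθ : Measurable (Function.uncurry θ))
    (hadd : ∀ s t ω, θ t (θ s ω) = θ (s + t) ω)
    {P : Measure Ω} [IsProbabilityMeasure P]
    (herg : ∀ A : Set Ω, MeasurableSet A → (∀ t, θ t ⁻¹' A = A) → P A = 0 ∨ P A = 1)
    {A : Set Ω} (hA : MeasurableSet A) (hinv : ∀ t, ∀ᵐ ω ∂P, θ t ω ∈ A ↔ ω ∈ A) :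
    (∀ᵐ ω ∂P, ω ∈ A) ∨ ∀ᵐ ω ∂P, ω ∉ A := by
  set B : Set Ω := {ω | volume {t : ℝ | θ t ω ∉ A} = 0} with hB
  have hBm : MeasurableSet B := by
    have hS : MeasurableSet {p : Ω × ℝ | θ p.2 p.1 ∉ A} :=
      (hθ.comp measurable_swap) hA.compl
    exact measurable_measure_prodMk_left hS (measurableSet_singleton 0)
  have hBinv : ∀ s, θ s ⁻¹' B = B := by
    intro s
    ext ω
    have : {t : ℝ | θ t (θ s ω) ∉ A} = (fun t => s + t) ⁻¹' {t : ℝ | θ t ω ∉ A} := by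
      ext t; simp [hadd]
    simp only [hB, Set.mem_preimage, Set.mem_ofPred_eq]
    rw [this, measure_preimage_add]
  have hae : ∀ᵐ ω ∂P, ∀ᵐ t : ℝ, θ t ω ∈ A ↔ ω ∈ A := by
    rw [Measure.ae_ae_comm]
    · exact .of_forall hinv
    · have h1 : MeasurableSet {p : Ω × ℝ | θ p.2 p.1 ∈ A} := (hθ.comp measurable_swap) hA
      have h2 : MeasurableSet {p : Ω × ℝ | p.1 ∈ A} := measurable_fst hA
      exact h1.iff h2
  have hBA : ∀ᵐ ω ∂P, ω ∈ B ↔ ω ∈ A := by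
    filter_upwards [hae] with ω hω
    have hBω : ω ∈ B ↔ ∀ᵐ t : ℝ, θ t ω ∈ A := Iff.rfl
    rw [hBω]
    constructor
    · intro h
      obtain ⟨t, h1, h2⟩ := (h.and hω).exists
      exact h2.1 h1
    · intro h
      filter_upwards [hω] with t ht using ht.2 h
  rcases herg B hBm hBinv with h | h
  · right
    filter_upwards [hBA, measure_eq_zero_iff_ae_notMem.1 h] with ω h1 h2
    rwa [← h1]
  · left
    filter_upwards [hBA, (mem_ae_iff_prob_eq_one hBm).2 h] with ω h1 h2
    exact h1.1 h2

/-- A finite invariant measure of an ergodic flow that is absolutely continuous with respect to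
the ergodic probability measure is a multiple of it. -/
theorem eq_smul_of_absolutelyContinuous_of_forall_map_eq {Ω : Type*} [MeasurableSpace Ω]
    {θ : ℝ → Ω → Ω} (hθ : Measurable (Function.uncurry θ))
    (hadd : ∀ s t ω, θ t (θ s ω) = θ (s + t) ω)
    {P ν : Measure Ω} [IsProbabilityMeasure P] [IsFiniteMeasure ν]
    (herg : ∀ A : Set Ω, MeasurableSet A → (∀ t, θ t ⁻¹' A = A) → P A = 0 ∨ P A = 1)
    (hP : ∀ t, P.map (θ t) = P) (hν : ∀ t, ν.map (θ t) = ν) (hac : ν ≪ P) :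
    ν = ν Set.univ • P := by
  have hθt : ∀ t, Measurable (θ t) := fun t => hθ.comp measurable_prodMk_left
  have hconst : ∃ c, ν.rnDeriv P =ᵐ[P] Function.const Ω c := by
    refine exists_eventuallyEq_const_of_forall_separating MeasurableSet fun U hU => ?_
    refine ae_mem_or_ae_notMem_of_forall_preimage_ae_eq hθ hadd herg
      (A := ν.rnDeriv P ⁻¹' U) (Measure.measurable_rnDeriv ν P hU) fun t => ?_
    filter_upwards [MeasurePreserving.rnDeriv_comp_aeEq ⟨hθt t, hν t⟩ ⟨hθt t, hP t⟩] with ω hω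
    rw [Set.mem_preimage, Set.mem_preimage, ← hω, Function.comp_apply]
  obtain ⟨c, hc⟩ := hconst
  have hνc : ν = c • P := by
    rw [← Measure.withDensity_rnDeriv_eq ν P hac, withDensity_congr_ae hc]
    exact withDensity_const c
  have hcu : ν Set.univ = c := by rw [hνc]; simp
  rw [hcu]
  exact hνc

theorem expMeasure_one_map_add_le {a : ℝ} (ha : 0 ≤ a) :
    (ProbabilityTheory.expMeasure 1).map (fun u => u + a) ≤
      ENNReal.ofReal (Real.exp a) • ProbabilityTheory.expMeasure 1 := by
  have hdens : ProbabilityTheory.expMeasure 1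
      = volume.withDensity (ProbabilityTheory.exponentialPDF 1) := rfl
  have hmeas : Measurable (ProbabilityTheory.exponentialPDF 1) :=
    (ProbabilityTheory.measurable_exponentialPDFReal 1).ennreal_ofReal
  refine Measure.le_iff.2 fun B hB => ?_
  have hadd : Measurable fun u : ℝ => u + a := measurable_add_const a
  rw [Measure.map_apply hadd hB, Measure.smul_apply, hdens, withDensity_apply _ (hadd hB),
    withDensity_apply _ hB, smul_eq_mul, ← lintegral_const_mul _ hmeas,
    ← lintegral_indicator (hadd hB), ← lintegral_indicator hB,
    ← lintegral_add_right_eq_self (B.indicator _) a]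
  refine lintegral_mono fun u => ?_
  by_cases hu : u + a ∈ B
  · rw [Set.indicator_of_mem (show u ∈ (fun u => u + a) ⁻¹' B from hu),
      Set.indicator_of_mem hu, ProbabilityTheory.exponentialPDF_eq,
      ProbabilityTheory.exponentialPDF_eq, ← ENNReal.ofReal_mul (Real.exp_pos a).le]
    refine ENNReal.ofReal_le_ofReal ?_
    by_cases h0 : 0 ≤ u
    · rw [if_pos h0, if_pos (by linarith), one_mul, one_mul, one_mul, one_mul, ← Real.exp_add]
      exact le_of_eq (by ring_nf)
    · rw [if_neg h0]
      split_ifs <;> positivity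
  · rw [Set.indicator_of_notMem (show u ∉ (fun u => u + a) ⁻¹' B from hu)]
    exact zero_le

theorem integral_expMeasure_one (g : ℝ → ℝ) :
    ∫ u, g u ∂ProbabilityTheory.expMeasure 1
      = ∫ u in Set.Ioi (0 : ℝ), Real.exp (-u) * g u := by
  have hdens : ProbabilityTheory.expMeasure 1
      = volume.withDensity (ProbabilityTheory.exponentialPDF 1) := rfl
  have hmeas : Measurable (ProbabilityTheory.exponentialPDF 1) :=
    (ProbabilityTheory.measurable_exponentialPDFReal 1).ennreal_ofReal
  rw [hdens, integral_withDensity_eq_integral_toReal_smul hmeas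
    (.of_forall fun _ => ENNReal.ofReal_lt_top), ← integral_Ici_eq_integral_Ioi,
    ← integral_indicator measurableSet_Ici]
  congr 1 with u
  rw [ProbabilityTheory.exponentialPDF_eq]
  by_cases hu : 0 ≤ u
  · rw [if_pos hu, Set.indicator_of_mem (Set.mem_Ici.2 hu), ENNReal.toReal_ofReal (by positivity)]
    simp
  · rw [if_neg hu, Set.indicator_of_notMem (by simpa using hu)]
    simp

theorem mul_integral_exp_eq_integral_expMeasure {ε : ℝ} (hε : 0 < ε) (g : ℝ → ℝ) :
    ε * ∫ t in Set.Ioi (0 : ℝ), Real.exp (-ε * t) * g t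
      = ∫ u, g (ε⁻¹ * u) ∂ProbabilityTheory.expMeasure 1 := by
  rw [integral_expMeasure_one]
  have h := integral_comp_mul_left_Ioi (fun t => Real.exp (-ε * t) * g t) 0 (inv_pos.2 hε)
  rw [mul_zero, inv_inv, smul_eq_mul] at h
  rw [← h]
  congr 1 with u
  congr 2
  field_simp

/-- Translation extends continuously to the one-point compactification. -/
theorem continuous_onePoint_map_add {E : Type*} [NormedAddCommGroup E] [ProperSpace E] :
    Continuous fun p : E × OnePoint E => p.2.map (fun x => x + p.1) := by
  rw [continuous_iff_continuousAt]
  rintro ⟨v, z⟩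
  cases z with
  | coe x =>
    have h : (𝓝 (v, (x : OnePoint E)))
        = Filter.map (Prod.map id OnePoint.some) (𝓝 (v, x)) := by
      rw [nhds_prod_eq, nhds_prod_eq, OnePoint.nhds_coe_eq, ← Filter.prod_map_map_eq',
        Filter.map_id]
    rw [ContinuousAt, h, Filter.tendsto_map'_iff]
    exact (OnePoint.continuous_coe.comp (continuous_snd.add continuous_fst)).tendsto (v, x)
  | infty =>
    rw [ContinuousAt, nhds_prod_eq, OnePoint.nhds_infty_eq, Filter.prod_sup, Filter.tendsto_sup,
      Filter.prod_pure, Filter.tendsto_map'_iff]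
    constructor
    · have h : 𝓝 v ×ˢ Filter.map OnePoint.some (coclosedCompact E)
          = Filter.map (Prod.map id OnePoint.some) (𝓝 v ×ˢ coclosedCompact E) := by
        rw [← Filter.prod_map_map_eq', Filter.map_id]
      rw [h, Filter.tendsto_map'_iff]
      refine OnePoint.tendsto_coe_infty.comp (?_ : Tendsto (fun p : E × E => p.2 + p.1) _ _)
      rw [coclosedCompact_eq_cocompact, ← Metric.cobounded_eq_cocompact,
        ← tendsto_norm_atTop_iff_cobounded]
      have h1 : Tendsto (fun p : E × E => -‖p.1‖) (𝓝 v ×ˢ Bornology.cobounded E) (𝓝 (-‖v‖)) :=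
        (tendsto_fst.norm).neg
      have h2 : Tendsto (fun p : E × E => ‖p.2‖) (𝓝 v ×ˢ Bornology.cobounded E) atTop :=
        tendsto_norm_cobounded_atTop.comp tendsto_snd
      refine tendsto_atTop_mono (fun p => ?_) (h2.atTop_add h1)
      have := norm_sub_le (p.2 + p.1) p.1
      simp only [add_sub_cancel_right] at this
      linarith
    · exact tendsto_const_nhds.congr' (.of_forall fun _ => rfl)

theorem continuous_polaronIncShift_uncurry (d : ℕ) :
    Continuous (Function.uncurry (polaronIncShift d)) := by
  refine Continuous.subtype_mk (ContinuousMap.continuous_of_continuous_uncurry _ ?_) _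
  have h1 : Continuous fun q : (ℝ × PolaronPath₀ d) × ℝ => q.1.2.1 (q.1.1 + q.2) := by fun_prop
  have h2 : Continuous fun q : (ℝ × PolaronPath₀ d) × ℝ => q.1.2.1 q.1.1 := by fun_prop
  exact h1.sub h2

theorem continuous_polaronShift (d : ℕ) (t : ℝ) : Continuous (polaronShift d t) := by
  refine ContinuousMap.continuous_of_continuous_uncurry _ ?_
  have h1 : Continuous fun q : PolaronPath d × ℝ => q.1 (t + q.2) := by fun_prop
  exact h1

theorem continuous_polaronInc (d : ℕ) : Continuous (polaronInc d) := by
  refine Continuous.subtype_mk (ContinuousMap.continuous_of_continuous_uncurry _ ?_) _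
  have h1 : Continuous fun q : PolaronPath d × ℝ => q.1 q.2 - q.1 0 := by fun_prop
  exact h1

theorem polaronIncShift_polaronIncShift (d : ℕ) (s t : ℝ) (ω : PolaronPath₀ d) :
    polaronIncShift d t (polaronIncShift d s ω) = polaronIncShift d (s + t) ω := by
  ext u : 2
  simp [polaronIncShift, add_assoc]

theorem polaronShift_polaronShift (d : ℕ) (s t : ℝ) (ω : PolaronPath d) :
    polaronShift d t (polaronShift d s ω) = polaronShift d (s + t) ω := by
  ext u : 1
  simp [polaronShift, add_assoc]

theorem polaronShift_zero (d : ℕ) : polaronShift d 0 = id := by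
  ext ω u : 2
  simp [polaronShift]

theorem polaronInc_polaronShift (d : ℕ) (t : ℝ) (ω : PolaronPath d) :
    polaronInc d (polaronShift d t ω) = polaronIncShift d t (polaronInc d ω) := by
  ext u : 2
  simp [polaronShift, polaronInc, polaronIncShift]

/-- Increments seen from time `t`, together with the position at time `t`. -/
noncomputable def pointedIncrements (d : ℕ) (t : ℝ) (ω : PolaronPath₀ d) :
    PolaronPath₀ d × OnePoint (EuclideanSpace ℝ (Fin d)) :=
  (polaronIncShift d t ω, (ω.1 t : OnePoint (EuclideanSpace ℝ (Fin d))))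

/-- The shift on pairs (increments, position), the position being allowed to be infinite. -/
noncomputable def pointedShift (d : ℕ) (s : ℝ)
    (p : PolaronPath₀ d × OnePoint (EuclideanSpace ℝ (Fin d))) :
    PolaronPath₀ d × OnePoint (EuclideanSpace ℝ (Fin d)) :=
  (polaronIncShift d s p.1, p.2.map (fun x => x + p.1.1 s))

/-- A path as a pair (increments, position at time `0`). -/
noncomputable def pointedPath (d : ℕ) (ω : PolaronPath d) :
    PolaronPath₀ d × OnePoint (EuclideanSpace ℝ (Fin d)) :=
  (polaronInc d ω, (ω 0 : OnePoint (EuclideanSpace ℝ (Fin d))))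

theorem continuous_pointedIncrements_uncurry (d : ℕ) :
    Continuous (Function.uncurry (pointedIncrements d)) := by
  refine (continuous_polaronIncShift_uncurry d).prodMk (OnePoint.continuous_coe.comp ?_)
  fun_prop

theorem continuous_pointedShift (d : ℕ) (s : ℝ) : Continuous (pointedShift d s) := by
  refine Continuous.prodMk ?_ ?_
  · exact (continuous_polaronIncShift_uncurry d).comp (continuous_const.prodMk continuous_fst)
  · have h : Continuous fun p : PolaronPath₀ d × OnePoint (EuclideanSpace ℝ (Fin d)) =>
        (p.1.1 s, p.2) := by fun_prop
    exact continuous_onePoint_map_add.comp h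

theorem continuous_pointedPath (d : ℕ) : Continuous (pointedPath d) := by
  refine (continuous_polaronInc d).prodMk (OnePoint.continuous_coe.comp ?_)
  fun_prop

theorem pointedPath_injective (d : ℕ) : Function.Injective (pointedPath d) := by
  intro ω ω' h
  obtain ⟨h1, h2⟩ := Prod.ext_iff.1 h
  have h2' : ω 0 = ω' 0 := OnePoint.coe_injective h2
  ext u : 1
  have h3 : ω u - ω 0 = ω' u - ω' 0 := congrArg (fun η : PolaronPath₀ d => η.1 u) h1
  rwa [h2', sub_left_inj] at h3

theorem range_pointedPath (d : ℕ) :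
    Set.range (pointedPath d) = {p | p.2 ≠ OnePoint.infty} := by
  ext ⟨η, z⟩
  constructor
  · rintro ⟨ω, h⟩
    have hz : ((ω 0 : EuclideanSpace ℝ (Fin d)) : OnePoint _) = z := (Prod.ext_iff.1 h).2
    exact hz ▸ OnePoint.coe_ne_infty _
  · intro h
    obtain ⟨x, rfl⟩ := OnePoint.ne_infty_iff_exists.1 h
    refine ⟨ContinuousMap.const ℝ x + η.1, ?_⟩
    refine Prod.ext ?_ ?_
    · ext u : 2
      simp [pointedPath, polaronInc, η.2]
    · simp [pointedPath, η.2]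

theorem pointedShift_pointedPath (d : ℕ) (s : ℝ) (ω : PolaronPath d) :
    pointedShift d s (pointedPath d ω) = pointedPath d (polaronShift d s ω) := by
  refine Prod.ext (polaronInc_polaronShift d s ω).symm ?_
  simp [pointedShift, pointedPath, polaronInc, polaronShift]

theorem pointedShift_pointedIncrements (d : ℕ) (s t : ℝ) (ω : PolaronPath₀ d) :
    pointedShift d s (pointedIncrements d t ω) = pointedIncrements d (t + s) ω := by
  refine Prod.ext (polaronIncShift_polaronIncShift d t s ω) ?_
  simp [pointedShift, pointedIncrements, polaronIncShift]

theorem image_pointedPath_preimage_polaronShift (d : ℕ) (s : ℝ) (A : Set (PolaronPath d)) :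
    pointedPath d '' (polaronShift d s ⁻¹' A) = pointedShift d s ⁻¹' (pointedPath d '' A) := by
  ext p
  constructor
  · rintro ⟨ω, hω, rfl⟩
    exact ⟨_, hω, (pointedShift_pointedPath d s ω).symm⟩
  · rintro ⟨ω, hω, h⟩
    have hp : p ∈ Set.range (pointedPath d) := by
      rw [range_pointedPath]
      intro hz
      have h2 := (Prod.ext_iff.1 h).2
      simp only [pointedPath, pointedShift, hz, OnePoint.map_infty] at h2
      exact OnePoint.coe_ne_infty _ h2
    obtain ⟨ω', rfl⟩ := hp
    rw [pointedShift_pointedPath] at h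
    refine ⟨ω', ?_, rfl⟩
    rw [Set.mem_preimage, ← pointedPath_injective d h]
    exact hω

instance instPolishSpacePolaronPath₀ (d : ℕ) : PolishSpace (PolaronPath₀ d) := by
  have h : IsClosed {ω : PolaronPath d | ω 0 = 0} :=
    isClosed_eq (continuous_eval_const 0) continuous_const
  exact h.polishSpace

instance instPolishSpaceOnePointEuclidean (d : ℕ) :
    PolishSpace (OnePoint (EuclideanSpace ℝ (Fin d))) := by
  have : PolishSpace (Metric.sphere (0 : EuclideanSpace ℝ (Fin (d + 1))) 1) :=
    Metric.isClosed_sphere.polishSpace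
  exact (onePointEquivSphereOfFinrankEq (V := EuclideanSpace ℝ (Fin d))
    (ι := Fin (d + 1)) (by simp)).isClosedEmbedding.polishSpace

section Occupation

variable {d : ℕ} [MeasurableSpace (PolaronPath d)] [BorelSpace (PolaronPath d)]
  [MeasurableSpace (OnePoint (EuclideanSpace ℝ (Fin d)))]
  [BorelSpace (OnePoint (EuclideanSpace ℝ (Fin d)))]

instance : IsProbabilityMeasure (ProbabilityTheory.expMeasure 1) :=
  ProbabilityTheory.isProbabilityMeasure_expMeasure one_pos

/-- The increments and the position of the process at an independent exponential time
with rate `ε`. -/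
noncomputable def exponentialTimeLaw (P : Measure (PolaronPath₀ d)) (ε : ℝ) :
    Measure (PolaronPath₀ d × OnePoint (EuclideanSpace ℝ (Fin d))) :=
  (P.prod (ProbabilityTheory.expMeasure 1)).map fun q => pointedIncrements d (ε⁻¹ * q.2) q.1

theorem continuous_pointedIncrements_smul (d : ℕ) (ε : ℝ) :
    Continuous fun q : PolaronPath₀ d × ℝ => pointedIncrements d (ε⁻¹ * q.2) q.1 :=
  (continuous_pointedIncrements_uncurry d).comp
    ((continuous_const.mul continuous_snd).prodMk continuous_fst)

instance (P : Measure (PolaronPath₀ d)) [IsProbabilityMeasure P] (ε : ℝ) :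
    IsProbabilityMeasure (exponentialTimeLaw P ε) :=
  Measure.isProbabilityMeasure_map (continuous_pointedIncrements_smul d ε).measurable.aemeasurable

theorem exponentialTimeLaw_fst (P : Measure (PolaronPath₀ d)) [IsProbabilityMeasure P]
    (hstat : ∀ t : ℝ, P.map (polaronIncShift d t) = P) (ε : ℝ) :
    (exponentialTimeLaw P ε).fst = P := by
  have hm := (continuous_polaronIncShift_uncurry d).measurable
  have hm' := (continuous_pointedIncrements_smul d ε).measurable
  ext A hA
  rw [Measure.fst_apply hA, exponentialTimeLaw, Measure.map_apply hm' (measurable_fst hA),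
    Measure.prod_apply_symm (hm' (measurable_fst hA))]
  have h : ∀ u : ℝ, P ((fun ω => (ω, u)) ⁻¹'
      ((fun q : PolaronPath₀ d × ℝ => pointedIncrements d (ε⁻¹ * q.2) q.1) ⁻¹'
        (Prod.fst ⁻¹' A))) = P A := by
    intro u
    have ht : Measurable (polaronIncShift d (ε⁻¹ * u)) := hm.comp measurable_prodMk_left
    conv_rhs => rw [← hstat (ε⁻¹ * u), Measure.map_apply ht hA]
    rfl
  simp [h]

theorem exponentialTimeLaw_map_pointedShift_le (P : Measure (PolaronPath₀ d))
    [IsProbabilityMeasure P] {ε s : ℝ} (hε : 0 < ε) (hs : 0 ≤ s) :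
    (exponentialTimeLaw P ε).map (pointedShift d s)
      ≤ ENNReal.ofReal (Real.exp (ε * s)) • exponentialTimeLaw P ε := by
  have hm := (continuous_pointedIncrements_smul d ε).measurable
  have hadd : Measurable fun u : ℝ => u + ε * s := measurable_add_const _
  have hcomp : pointedShift d s ∘ (fun q : PolaronPath₀ d × ℝ =>
      pointedIncrements d (ε⁻¹ * q.2) q.1) =
      (fun q : PolaronPath₀ d × ℝ => pointedIncrements d (ε⁻¹ * q.2) q.1) ∘
        Prod.map id (fun u => u + ε * s) := by
    ext1 q
    simp only [Function.comp_apply, Prod.map, id, pointedShift_pointedIncrements]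
    congr 1
    field_simp
  rw [exponentialTimeLaw, Measure.map_map (continuous_pointedShift d s).measurable hm, hcomp,
    ← Measure.map_map hm (measurable_id.prodMap hadd), ← Measure.map_smul]
  refine Measure.map_mono ?_ hm
  rw [← Measure.map_prod_map _ _ measurable_id hadd, Measure.map_id, ← Measure.prod_smul_right]
  exact Measure.prod_mono le_rfl (expMeasure_one_map_add_le (by positivity))
/-- `exponentialTimeLaw` as a point of the space of probability measures. -/
noncomputable def exponentialTimeProb (P : Measure (PolaronPath₀ d)) [IsProbabilityMeasure P]
    (ε : ℝ) : ProbabilityMeasure (PolaronPath₀ d × OnePoint (EuclideanSpace ℝ (Fin d))) :=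
  ⟨exponentialTimeLaw P ε, inferInstance⟩

theorem exists_tendsto_exponentialTimeLaw (P : Measure (PolaronPath₀ d)) [IsProbabilityMeasure P]
    (hstat : ∀ t : ℝ, P.map (polaronIncShift d t) = P) (U : Ultrafilter ℝ) :
    ∃ R : ProbabilityMeasure (PolaronPath₀ d × OnePoint (EuclideanSpace ℝ (Fin d))),
      Tendsto (exponentialTimeProb P) U (𝓝 R) ∧
        (R : Measure (PolaronPath₀ d × OnePoint (EuclideanSpace ℝ (Fin d)))).fst = P := by
  let S : Set (ProbabilityMeasure (PolaronPath₀ d × OnePoint (EuclideanSpace ℝ (Fin d)))) :=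
    {R | (R : Measure (PolaronPath₀ d × OnePoint (EuclideanSpace ℝ (Fin d)))).fst = P}
  have hcomp : IsCompact (closure S) := by
    refine isCompact_closure_of_isTightMeasureSet (.prodMk ?_ .of_compactSpace)
    refine (isTightMeasureSet_singleton (μ := P)).subset ?_
    rintro _ ⟨_, ⟨R, hR, rfl⟩, rfl⟩
    exact hR
  have hQS : ∀ ε, exponentialTimeProb P ε ∈ S := exponentialTimeLaw_fst P hstat
  obtain ⟨R, -, hR⟩ := hcomp.ultrafilter_le_nhds (U.map (exponentialTimeProb P))
    (Filter.le_principal_iff.2 (Filter.Eventually.of_forall fun ε => subset_closure (hQS ε) :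
      ∀ᶠ ε in (U : Filter ℝ), exponentialTimeProb P ε ∈ closure S))
  refine ⟨R, hR, ?_⟩
  have hmap := ProbabilityMeasure.tendsto_map_of_tendsto_of_continuous _ R hR continuous_fst
  let P' : ProbabilityMeasure (PolaronPath₀ d) := ⟨P, inferInstance⟩
  have hconst : ∀ ε, (exponentialTimeProb P ε).map
      continuous_fst.measurable.aemeasurable = P' :=
    fun ε => Subtype.ext (hQS ε)
  simp only [hconst] at hmap
  have hR' := tendsto_nhds_unique hmap (tendsto_const_nhds (x := P'))
  exact congrArg (fun μ : ProbabilityMeasure (PolaronPath₀ d) =>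
    (μ : Measure (PolaronPath₀ d))) hR'

theorem map_pointedShift_eq_of_tendsto (P : Measure (PolaronPath₀ d)) [IsProbabilityMeasure P]
    {U : Filter ℝ} [U.NeBot] (hU : U ≤ 𝓝[>] 0)
    {R : ProbabilityMeasure (PolaronPath₀ d × OnePoint (EuclideanSpace ℝ (Fin d)))}
    (hR : Tendsto (exponentialTimeProb P) U (𝓝 R)) {s : ℝ} (hs : 0 ≤ s) :
    (R : Measure _).map (pointedShift d s) = R := by
  have hc := continuous_pointedShift d s
  have hlim := ProbabilityMeasure.tendsto_iff_forall_integral_tendsto.1 hR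
  have hexp : Tendsto (fun ε : ℝ => Real.exp (ε * s)) U (𝓝 1) := by
    have h : Tendsto (fun ε : ℝ => Real.exp (ε * s)) (𝓝 0) (𝓝 (Real.exp (0 * s))) :=
      Continuous.tendsto (by fun_prop) 0
    rw [zero_mul, Real.exp_zero] at h
    exact h.mono_left (hU.trans nhdsWithin_le_nhds)
  have hle : ∀ f : BoundedContinuousFunction _ ℝ, (∀ p, 0 ≤ f p) →
      ∫ p, f (pointedShift d s p) ∂(R : Measure _) ≤ ∫ p, f p ∂(R : Measure _) := by
    intro f hf
    have h1 := hlim (f.compContinuous ⟨_, hc⟩)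
    have h2 := hexp.mul (hlim f)
    rw [one_mul] at h2
    refine le_of_tendsto_of_tendsto h1 h2 ?_
    filter_upwards [hU self_mem_nhdsWithin] with ε hε
    have h3 := exponentialTimeLaw_map_pointedShift_le P (Set.mem_Ioi.1 hε) hs
    calc ∫ p, f (pointedShift d s p) ∂exponentialTimeLaw P ε
        = ∫ p, f p ∂(exponentialTimeLaw P ε).map (pointedShift d s) :=
          (integral_map hc.measurable.aemeasurable f.continuous.aestronglyMeasurable).symm
      _ ≤ ∫ p, f p ∂(ENNReal.ofReal (Real.exp (ε * s)) • exponentialTimeLaw P ε) := by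
          refine integral_mono_measure h3 (.of_forall hf) ?_
          exact (f.integrable _).smul_measure ENNReal.ofReal_ne_top
      _ = Real.exp (ε * s) * ∫ p, f p ∂exponentialTimeLaw P ε := by
          rw [integral_smul_measure, ENNReal.toReal_ofReal (Real.exp_pos _).le, smul_eq_mul]
  have : IsProbabilityMeasure ((R : Measure _).map (pointedShift d s)) :=
    Measure.isProbabilityMeasure_map hc.measurable.aemeasurable
  refine ext_of_forall_integral_eq_of_IsFiniteMeasure fun f => ?_
  rw [integral_map hc.measurable.aemeasurable f.continuous.aestronglyMeasurable]
  have hfi : Integrable f (R : Measure _) := f.integrable _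
  have hfsi : Integrable (fun p => f (pointedShift d s p)) (R : Measure _) :=
    (f.compContinuous ⟨_, hc⟩).integrable _
  refine le_antisymm ?_ ?_
  · have h := hle (f + BoundedContinuousFunction.const _ ‖f‖) fun p => by
      have := (abs_le.1 (f.norm_coe_le_norm p)).1
      simp only [BoundedContinuousFunction.coe_add, Pi.add_apply, BoundedContinuousFunction.const_apply]
      linarith
    simp only [BoundedContinuousFunction.coe_add, Pi.add_apply,
      BoundedContinuousFunction.const_apply] at h
    rw [integral_add hfsi (integrable_const _), integral_add hfi (integrable_const _)] at h
    linarith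
  · have h := hle (BoundedContinuousFunction.const _ ‖f‖ - f) fun p => by
      have := (abs_le.1 (f.norm_coe_le_norm p)).2
      simp only [BoundedContinuousFunction.coe_sub, Pi.sub_apply, BoundedContinuousFunction.const_apply]
      linarith
    simp only [BoundedContinuousFunction.coe_sub, Pi.sub_apply,
      BoundedContinuousFunction.const_apply] at h
    rw [integral_sub (integrable_const _) hfsi, integral_sub (integrable_const _) hfi] at h
    linarith

theorem measurableEmbedding_pointedPath (d : ℕ) [MeasurableSpace (PolaronPath d)]
    [BorelSpace (PolaronPath d)] [MeasurableSpace (OnePoint (EuclideanSpace ℝ (Fin d)))]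
    [BorelSpace (OnePoint (EuclideanSpace ℝ (Fin d)))] :
    MeasurableEmbedding (pointedPath d) :=
  (continuous_pointedPath d).measurableEmbedding (pointedPath_injective d)

/-- The finite part of a shift-invariant law on pairs (increments, position) is stationary. -/
theorem map_polaronShift_comap_pointedPath
    {R : Measure (PolaronPath₀ d × OnePoint (EuclideanSpace ℝ (Fin d)))}
    (hR : ∀ s, 0 ≤ s → R.map (pointedShift d s) = R) (t : ℝ) :
    (R.comap (pointedPath d)).map (polaronShift d t) = R.comap (pointedPath d) := by
  have hψ := measurableEmbedding_pointedPath d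
  have hpos : ∀ s, 0 ≤ s →
      (R.comap (pointedPath d)).map (polaronShift d s) = R.comap (pointedPath d) := by
    intro s hs
    ext A hA
    rw [Measure.map_apply (continuous_polaronShift d s).measurable hA, hψ.comap_apply,
      hψ.comap_apply, image_pointedPath_preimage_polaronShift,
      ← Measure.map_apply (continuous_pointedShift d s).measurable
        (hψ.measurableSet_image.2 hA), hR s hs]
  rcases le_total 0 t with ht | ht
  · exact hpos t ht
  · conv_lhs => rw [← hpos (-t) (by linarith)]
    rw [Measure.map_map (continuous_polaronShift d t).measurable
      (continuous_polaronShift d (-t)).measurable]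
    have : polaronShift d t ∘ polaronShift d (-t) = id := by
      ext1 ω
      rw [Function.comp_apply, polaronShift_polaronShift, neg_add_cancel, polaronShift_zero]
    rw [this, Measure.map_id]

theorem map_polaronInc_comap_pointedPath_le
    (R : Measure (PolaronPath₀ d × OnePoint (EuclideanSpace ℝ (Fin d)))) :
    (R.comap (pointedPath d)).map (polaronInc d) ≤ R.fst := by
  refine Measure.le_iff.2 fun A hA => ?_
  rw [Measure.map_apply (continuous_polaronInc d).measurable hA,
    (measurableEmbedding_pointedPath d).comap_apply, Measure.fst_apply hA]
  refine measure_mono ?_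
  rintro _ ⟨ω, hω, rfl⟩
  exact hω

theorem integral_exponentialTimeLaw (P : Measure (PolaronPath₀ d)) [IsProbabilityMeasure P]
    {ε : ℝ} (hε : 0 < ε) {V : EuclideanSpace ℝ (Fin d) → ℝ}
    {W : BoundedContinuousFunction
      (PolaronPath₀ d × OnePoint (EuclideanSpace ℝ (Fin d))) ℝ}
    (hW : ∀ η x, W (η, OnePoint.some x) = V x) :
    ε * ∫ ω, (∫ t in Set.Ioi (0 : ℝ), Real.exp (-ε * t) * V (ω.1 t)) ∂P
      = ∫ p, W p ∂exponentialTimeLaw P ε := by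
  have hm := continuous_pointedIncrements_smul d ε
  rw [exponentialTimeLaw, integral_map hm.measurable.aemeasurable
    W.continuous.aestronglyMeasurable, integral_prod, ← integral_const_mul]
  · congr 1 with ω
    rw [mul_integral_exp_eq_integral_expMeasure hε fun t => V (ω.1 t)]
    congr 1 with u
    exact (hW _ _).symm
  · exact (W.compContinuous ⟨_, hm⟩).integrable _

end Occupation

/-- Theorem 3 of Mukherjee–Varadhan: let `P` be an ergodic process with stationary
increments on `X₀ = {ω ∈ C(ℝ,ℝ^d) : ω(0) = 0}`.  Then either
`ε ∫ (∫_0^∞ e^{-εt} V(ω(t)) dt) dP → 0` as `ε → 0⁺` for every continuous compactly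
supported `V : ℝ^d → ℝ`, or `P` is the distribution of the increments of some stationary
process `Q` on `X = C(ℝ,ℝ^d)`. -/
theorem stationary_increments_dichotomy (d : ℕ) (hd : 1 ≤ d)
    [MeasurableSpace (PolaronPath d)] [BorelSpace (PolaronPath d)]
    (P : Measure (PolaronPath₀ d)) [IsProbabilityMeasure P]
    (hstat : ∀ t : ℝ, P.map (polaronIncShift d t) = P)
    (herg : ∀ A : Set (PolaronPath₀ d), MeasurableSet A →
      (∀ t : ℝ, polaronIncShift d t ⁻¹' A = A) → P A = 0 ∨ P A = 1) :
    (∀ V : EuclideanSpace ℝ (Fin d) → ℝ, Continuous V → HasCompactSupport V →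
      Filter.Tendsto (fun ε : ℝ =>
          ε * ∫ ω, (∫ t in Set.Ioi (0 : ℝ), Real.exp (-ε * t) * V (ω.1 t)) ∂P)
        (𝓝[>] (0 : ℝ)) (𝓝 0)) ∨
    (∃ Q : Measure (PolaronPath d), IsProbabilityMeasure Q ∧
      (∀ t : ℝ, Q.map (polaronShift d t) = Q) ∧ Q.map (polaronInc d) = P) := by
  let _ : MeasurableSpace (OnePoint (EuclideanSpace ℝ (Fin d))) := borel _
  have _ : BorelSpace (OnePoint (EuclideanSpace ℝ (Fin d))) := ⟨rfl⟩
  refine or_iff_not_imp_left.2 fun hnot => ?_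
  push Not at hnot
  obtain ⟨V, hV, hVc, hlim⟩ := hnot
  obtain ⟨N, hN, hfreq⟩ := Filter.not_tendsto_iff_exists_frequently_notMem.1 hlim
  have hne : (𝓝[>] (0 : ℝ) ⊓ 𝓟 {ε | ε * ∫ ω, (∫ t in Set.Ioi (0 : ℝ),
      Real.exp (-ε * t) * V (ω.1 t)) ∂P ∉ N}).NeBot :=
    Filter.frequently_mem_iff_neBot.1 hfreq
  let U := Ultrafilter.of (𝓝[>] (0 : ℝ) ⊓ 𝓟 {ε | ε * ∫ ω, (∫ t in Set.Ioi (0 : ℝ),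
      Real.exp (-ε * t) * V (ω.1 t)) ∂P ∉ N})
  have hU := Ultrafilter.of_le (𝓝[>] (0 : ℝ) ⊓ 𝓟 {ε | ε * ∫ ω, (∫ t in Set.Ioi (0 : ℝ),
      Real.exp (-ε * t) * V (ω.1 t)) ∂P ∉ N})
  have hU0 : (U : Filter ℝ) ≤ 𝓝[>] 0 := hU.trans inf_le_left
  obtain ⟨R, hR, hRfst⟩ := exists_tendsto_exponentialTimeLaw P hstat U
  have hRinv : ∀ s, 0 ≤ s → (R : Measure _).map (pointedShift d s) = R :=
    fun s hs => map_pointedShift_eq_of_tendsto P hU0 hR hs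
  set Q := (R : Measure (PolaronPath₀ d × OnePoint (EuclideanSpace ℝ (Fin d)))).comap
    (pointedPath d) with hQ
  have hψ := measurableEmbedding_pointedPath d
  have hQinv : ∀ t, Q.map (polaronShift d t) = Q := map_polaronShift_comap_pointedPath hRinv
  have hQle : Q.map (polaronInc d) ≤ P := hRfst ▸ map_polaronInc_comap_pointedPath_le _
  have hincm := (continuous_polaronInc d).measurable
  have hθm := (continuous_polaronIncShift_uncurry d).measurable
  have hQfin : IsFiniteMeasure Q := by
    constructor
    rw [hQ, hψ.comap_apply]
    exact measure_lt_top _ _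
  have hQmap : Q.map (polaronInc d) = Q Set.univ • P := by
    have h := eq_smul_of_absolutelyContinuous_of_forall_map_eq hθm
      (polaronIncShift_polaronIncShift d) herg hstat (ν := Q.map (polaronInc d)) (fun t => by
        conv_rhs => rw [← hQinv t]
        rw [Measure.map_map (show Measurable (polaronIncShift d t) from
            hθm.comp measurable_prodMk_left) hincm,
          Measure.map_map hincm (continuous_polaronShift d t).measurable]
        congr 1 with ω : 1
        exact (polaronInc_polaronShift d t ω).symm) (Measure.absolutelyContinuous_of_le hQle)
    rwa [Measure.map_apply hincm .univ, Set.preimage_univ] at h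
  have hQpos : Q Set.univ ≠ 0 := by
    intro h0
    have hW0 : Continuous fun z : OnePoint (EuclideanSpace ℝ (Fin d)) => z.elim 0 V := by
      refine (OnePoint.continuous_iff _).2 ⟨?_, hV⟩
      have hVc' := hasCompactSupport_iff_eventuallyEq.1 hVc
      exact tendsto_const_nhds.congr' hVc'.symm
    obtain ⟨W, hW⟩ : ∃ W : BoundedContinuousFunction
        (PolaronPath₀ d × OnePoint (EuclideanSpace ℝ (Fin d))) ℝ,
        ∀ p, W p = p.2.elim 0 V :=
      ⟨(BoundedContinuousFunction.mkOfCompact ⟨_, hW0⟩).compContinuous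
        ⟨Prod.snd, continuous_snd⟩, fun p => rfl⟩
    have hzero : ∫ p, W p ∂(R : Measure _) = 0 := by
      refine integral_eq_zero_of_ae ?_
      have hnull : (R : Measure _) (Set.range (pointedPath d)) = 0 := by
        rwa [hQ, hψ.comap_apply, Set.image_univ] at h0
      filter_upwards [measure_eq_zero_iff_ae_notMem.1 hnull] with p hp
      rw [range_pointedPath, Set.mem_ofPred_eq, not_not] at hp
      rw [hW, hp]
      rfl
    have htend := ProbabilityMeasure.tendsto_iff_forall_integral_tendsto.1 hR W
    rw [hzero] at htend
    obtain ⟨ε, ⟨hε1, hε2⟩, hε3⟩ :=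
      ((((htend.eventually hN : ∀ᶠ ε in (U : Filter ℝ),
        ∫ p, W p ∂exponentialTimeLaw P ε ∈ N)).and (hU0 self_mem_nhdsWithin)).and
        (hU (Filter.mem_inf_of_right (Filter.mem_principal_self _)))).exists
    refine hε3 ?_
    rw [integral_exponentialTimeLaw P hε2 (W := W) fun η x => hW _]
    exact hε1
  have hQtop : Q Set.univ ≠ ⊤ := measure_ne_top _ _
  refine ⟨(Q Set.univ)⁻¹ • Q, ⟨?_⟩, fun t => ?_, ?_⟩
  · rw [Measure.smul_apply, smul_eq_mul, ENNReal.inv_mul_cancel hQpos hQtop]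
  · rw [Measure.map_smul, hQinv t]
  · rw [Measure.map_smul, hQmap, smul_smul, ENNReal.inv_mul_cancel hQpos hQtop, one_smul]
end

section
/- For every σ > 0 and every x ∈ ℝ³, ∫_{ℝ³} (2πσ)^{−3/2} e^{−‖y−x‖²/(2σ)} ‖y‖^{−3/2} dy ≤ ∫_{ℝ³} (2πσ)^{−3/2} e^{−‖y‖²/(2σ)} ‖y‖^{−3/2} dy; that is, the Gaussian smoothing of the function y ↦ ‖y‖^{−3/2} attains its supremum over the center x at x = 0. -/
open MeasureTheory Real

/-- If `f` and `g` are nonnegative and even, and similarly ordered almost everywhere along the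
translation by `x`, then the correlation of `g` with `f` at `x` is at most the one at the origin. -/
theorem integral_comp_sub_mul_le {E : Type*} [NormedAddCommGroup E] [MeasurableSpace E]
    [BorelSpace E] {μ : Measure E} [μ.IsAddLeftInvariant] [μ.IsNegInvariant] {f g : E → ℝ}
    (hf : Measurable f) (hg : Measurable g) (hf0 : 0 ≤ f) (hg0 : 0 ≤ g)
    (hfe : ∀ y, f (-y) = f y) (hge : ∀ y, g (-y) = g y)
    (hgf : Integrable (fun y => g y * f y) μ) (x : E)
    (hmono : ∀ᵐ y ∂μ, 0 ≤ (g y - g (y - x)) * (f y - f (y - x))) :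
    ∫ y, g (y - x) * f y ∂μ ≤ ∫ y, g y * f y ∂μ := by
  have hshift : Integrable (fun y => g (y - x) * f (y - x)) μ := hgf.comp_sub_right x
  have hle : ∀ᵐ y ∂μ, g (y - x) * f y + g y * f (y - x) ≤ g y * f y + g (y - x) * f (y - x) := by
    filter_upwards [hmono] with y hy
    linarith
  have hint : Integrable (fun y => g (y - x) * f y) μ := by
    refine (hgf.add hshift).mono' (by fun_prop) ?_
    filter_upwards [hle] with y hy
    rw [Real.norm_of_nonneg (mul_nonneg (hg0 _) (hf0 _))]
    exact (le_add_of_nonneg_right (mul_nonneg (hg0 _) (hf0 _))).trans hy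
  have hreflect : (fun y => g (x - y - x) * f (x - y)) = fun y => g y * f (y - x) := by
    funext y
    rw [show x - y - x = -y by abel, hge, ← neg_sub y x, hfe]
  have hint' : Integrable (fun y => g y * f (y - x)) μ := by
    rw [← hreflect]
    exact hint.comp_sub_left x
  have heq : ∫ y, g y * f (y - x) ∂μ = ∫ y, g (y - x) * f y ∂μ := by
    rw [← hreflect]
    exact integral_sub_left_eq_self (fun y => g (y - x) * f y) μ x
  have heq' : ∫ y, g (y - x) * f (y - x) ∂μ = ∫ y, g y * f y ∂μ :=
    integral_sub_right_eq_self (fun y => g y * f y) x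
  have h := integral_mono_ae (hint.add hint') (hgf.add hshift) hle
  simp only [Pi.add_apply] at h
  rw [integral_add hint hint', integral_add hgf hshift, heq, heq'] at h
  linarith

theorem integrable_exp_neg_mul_sq_norm_mul_rpow_norm {b : ℝ} (hb : 0 < b) :
    Integrable (fun y : EuclideanSpace ℝ (Fin 3) =>
      Real.exp (-b * ‖y‖ ^ 2) * ‖y‖ ^ (-(3 : ℝ) / 2)) := by
  rw [integrable_fun_norm_addHaar volume
    (f := fun r : ℝ => Real.exp (-b * r ^ 2) * r ^ (-(3 : ℝ) / 2))]
  refine (integrableOn_rpow_mul_exp_neg_mul_sq hb (s := 1 / 2) (by norm_num)).congr_fun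
    (fun r hr => ?_) measurableSet_Ioi
  have hr : 0 < r := hr
  have hpow : r ^ (1 / 2 : ℝ) = r ^ 2 * r ^ (-(3 : ℝ) / 2) := by
    rw [← Real.rpow_natCast, ← Real.rpow_add hr]
    norm_num
  simp only [finrank_euclideanSpace, Fintype.card_fin, smul_eq_mul, hpow]
  norm_num
  ring

/-- The Gaussian smoothing of `y ↦ ‖y‖^{-3/2}` attains its supremum over the center `x`
at `x = 0`. -/
theorem gaussian_smoothing_sup_at_zero (σ : ℝ) (hσ : 0 < σ) (x : EuclideanSpace ℝ (Fin 3)) :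
    ∫ y : EuclideanSpace ℝ (Fin 3),
        (2 * Real.pi * σ) ^ (-(3 : ℝ) / 2) * Real.exp (-‖y - x‖ ^ 2 / (2 * σ)) *
          ‖y‖ ^ (-(3 : ℝ) / 2)
      ≤ ∫ y : EuclideanSpace ℝ (Fin 3),
        (2 * Real.pi * σ) ^ (-(3 : ℝ) / 2) * Real.exp (-‖y‖ ^ 2 / (2 * σ)) *
          ‖y‖ ^ (-(3 : ℝ) / 2) := by
  have hc : 0 < (2 * Real.pi * σ) ^ (-(3 : ℝ) / 2) := by positivity
  have hanti : ∀ a b : ℝ, 0 < a → a ≤ b →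
      Real.exp (-b ^ 2 / (2 * σ)) ≤ Real.exp (-a ^ 2 / (2 * σ)) ∧
        b ^ (-(3 : ℝ) / 2) ≤ a ^ (-(3 : ℝ) / 2) := fun a b ha hab =>
    ⟨by gcongr, Real.rpow_le_rpow_of_nonpos ha hab (by norm_num)⟩
  refine integral_comp_sub_mul_le
    (f := fun y : EuclideanSpace ℝ (Fin 3) => ‖y‖ ^ (-(3 : ℝ) / 2))
    (g := fun y => (2 * Real.pi * σ) ^ (-(3 : ℝ) / 2) * Real.exp (-‖y‖ ^ 2 / (2 * σ)))
    (by fun_prop) (by fun_prop) (fun y => by positivity) (fun y => by positivity)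
    (fun y => by simp only [norm_neg]) (fun y => by simp only [norm_neg]) ?_ x ?_
  · refine ((integrable_exp_neg_mul_sq_norm_mul_rpow_norm (b := 1 / (2 * σ))
      (by positivity)).const_mul ((2 * Real.pi * σ) ^ (-(3 : ℝ) / 2))).congr (ae_of_all _ fun y => ?_)
    simp only [mul_assoc]
    ring_nf
  · filter_upwards [Measure.ae_ne volume 0, Measure.ae_ne volume x] with y hy hyx
    have hy : 0 < ‖y‖ := norm_pos_iff.2 hy
    have hyx : 0 < ‖y - x‖ := norm_pos_iff.2 (sub_ne_zero.2 hyx)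
    rw [← mul_sub, mul_assoc]
    refine mul_nonneg hc.le ?_
    rcases le_total ‖y‖ ‖y - x‖ with h | h
    · obtain ⟨h₁, h₂⟩ := hanti _ _ hy h
      exact mul_nonneg (sub_nonneg.2 h₁) (sub_nonneg.2 h₂)
    · obtain ⟨h₁, h₂⟩ := hanti _ _ hyx h
      exact mul_nonneg_of_nonpos_of_nonpos (sub_nonpos.2 h₁) (sub_nonpos.2 h₂)
end

section
/- Let X be a Polish space, d ≥ 1, and let (μ_n) be a sequence of Borel probability measures on X × ℝ^d whose marginals on X form a uniformly tight family. Then there exist a subsequence (μ_{n_k}) and a finite Borel measure μ on X × ℝ^d such that ∫ F dμ_{n_k} → ∫ F dμ for every bounded continuous function F : X × ℝ^d → ℝ satisfying lim_{R→∞} sup { |F(x,a)| : x ∈ X, ‖a‖ ≥ R } = 0. -/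
open MeasureTheory Filter Topology

/-- The one-point compactification of a finite-dimensional real vector space is a sphere, hence
metrizable. -/
theorem OnePoint.metrizableSpace_of_finiteDimensional (V : Type*) [AddCommGroup V] [Module ℝ V]
    [FiniteDimensional ℝ V] [TopologicalSpace V] [IsTopologicalAddGroup V] [ContinuousSMul ℝ V]
    [T2Space V] : TopologicalSpace.MetrizableSpace (OnePoint V) :=
  (onePointEquivSphereOfFinrankEq (ι := Fin (Module.finrank ℝ V + 1))
    (by simp)).isEmbedding.metrizableSpace

/-- A continuous function on `X × E` vanishing as `‖a‖ → ∞` uniformly in `x` extends continuously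
by zero to `X × OnePoint E`. -/
theorem continuous_onePoint_elim_zero {X E : Type*} [TopologicalSpace X] [NormedAddCommGroup E]
    [ProperSpace E] {F : X × E → ℝ} (hF : Continuous F)
    (hF0 : ∀ δ : ℝ, 0 < δ → ∃ R : ℝ, ∀ (x : X) (a : E), R ≤ ‖a‖ → |F (x, a)| ≤ δ) :
    Continuous fun p : X × OnePoint E => p.2.elim 0 fun a => F (p.1, a) := by
  rw [continuous_iff_continuousAt]
  rintro ⟨x, y⟩
  induction y using OnePoint.rec with
  | coe a =>
    have hj : IsOpenEmbedding (Prod.map id (↑) : X × E → X × OnePoint E) :=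
      IsOpenEmbedding.id.prodMap OnePoint.isOpenEmbedding_coe
    exact (hj.continuousAt_iff (x := (x, a))).1 hF.continuousAt
  | infty =>
    refine Metric.tendsto_nhds.2 fun ε hε => ?_
    obtain ⟨R, hR⟩ := hF0 (ε / 2) (half_pos hε)
    have hU : ((↑) '' Metric.closedBall (0 : E) R : Set (OnePoint E))ᶜ ∈ 𝓝 OnePoint.infty :=
      (OnePoint.isOpen_compl_image_coe.2
        ⟨Metric.isClosed_closedBall, isCompact_closedBall 0 R⟩).mem_nhds (by simp)
    filter_upwards [continuousAt_snd.preimage_mem_nhds hU] with ⟨x', y⟩ hy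
    induction y using OnePoint.rec with
    | infty => simpa using hε
    | coe b =>
      have hb : R < ‖b‖ := by simpa using hy
      simpa using (hR x' b hb.le).trans_lt (half_lt_self hε)

/-- Wea-gue sequential compactness: a sequence of Borel probability measures on `X × ℝ^d`
(`X` Polish) whose `X`-marginals are uniformly tight has a subsequence converging wea-guely,
i.e. tested against bounded continuous functions `F(x,a)` vanishing as `‖a‖ → ∞` uniformly
in `x`, to some finite Borel measure. -/
theorem weague_sequential_compactness (X : Type*) [TopologicalSpace X] [PolishSpace X]
    [MeasurableSpace X] [BorelSpace X] (d : ℕ) (hd : 1 ≤ d)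
    (μ : ℕ → Measure (X × EuclideanSpace ℝ (Fin d)))
    (hprob : ∀ n, IsProbabilityMeasure (μ n))
    (htight : ∀ δ : ℝ, 0 < δ → ∃ K : Set X, IsCompact K ∧
      ∀ n, μ n (Kᶜ ×ˢ (Set.univ : Set (EuclideanSpace ℝ (Fin d)))) ≤ ENNReal.ofReal δ) :
    ∃ φ : ℕ → ℕ, StrictMono φ ∧
      ∃ ν : Measure (X × EuclideanSpace ℝ (Fin d)), IsFiniteMeasure ν ∧
        ∀ F : X × EuclideanSpace ℝ (Fin d) → ℝ, Continuous F → (∃ M : ℝ, ∀ p, |F p| ≤ M) →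
          (∀ δ : ℝ, 0 < δ → ∃ R : ℝ, ∀ (x : X) (a : EuclideanSpace ℝ (Fin d)),
            R ≤ ‖a‖ → |F (x, a)| ≤ δ) →
          Filter.Tendsto (fun k => ∫ p, F p ∂(μ (φ k))) atTop (𝓝 (∫ p, F p ∂ν)) := by
  have := OnePoint.metrizableSpace_of_finiteDimensional (EuclideanSpace ℝ (Fin d))
  let _ : MeasurableSpace (OnePoint (EuclideanSpace ℝ (Fin d))) := borel _
  have : BorelSpace (OnePoint (EuclideanSpace ℝ (Fin d))) := ⟨rfl⟩
  let _ : MetricSpace (OnePoint (EuclideanSpace ℝ (Fin d))) :=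
    TopologicalSpace.metrizableSpaceMetric _
  let j : X × EuclideanSpace ℝ (Fin d) → X × OnePoint (EuclideanSpace ℝ (Fin d)) :=
    Prod.map id (↑)
  have hj : MeasurableEmbedding j :=
    (IsOpenEmbedding.id.prodMap OnePoint.isOpenEmbedding_coe).measurableEmbedding
  let P : ℕ → ProbabilityMeasure (X × OnePoint (EuclideanSpace ℝ (Fin d))) := fun n =>
    ⟨(μ n).map j, Measure.isProbabilityMeasure_map hj.measurable.aemeasurable⟩
  have hP : IsTightMeasureSet
      {((Q : ProbabilityMeasure (X × OnePoint (EuclideanSpace ℝ (Fin d)))) :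
        Measure (X × OnePoint (EuclideanSpace ℝ (Fin d)))) | Q ∈ Set.range P} := by
    rw [isTightMeasureSet_iff_exists_isCompact_measure_compl_le]
    intro ε hε
    obtain ⟨δ, hδ, hδε⟩ : ∃ δ : ℝ, 0 < δ ∧ ENNReal.ofReal δ ≤ ε := by
      obtain ⟨r, hr, hrε⟩ := ENNReal.lt_iff_exists_nnreal_btwn.1 hε
      exact ⟨r, by simpa using hr, by simpa using hrε.le⟩
    obtain ⟨K, hK, hμK⟩ := htight δ hδ
    refine ⟨K ×ˢ Set.univ, hK.prod isCompact_univ, ?_⟩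
    rintro _ ⟨_, ⟨n, rfl⟩, rfl⟩
    refine le_trans ?_ ((hμK n).trans hδε)
    change (μ n).map j _ ≤ _
    rw [hj.map_apply]
    exact measure_mono fun p hp => by simpa [j] using hp
  obtain ⟨Q, -, φ, hφ, hQ⟩ := (isCompact_closure_of_isTightMeasureSet hP).tendsto_subseq
    fun n => subset_closure (Set.mem_range_self n)
  rw [ProbabilityMeasure.tendsto_iff_forall_integral_tendsto] at hQ
  refine ⟨φ, hφ, Q.toMeasure.comap j, ?_, fun F hF ⟨M, hM⟩ hF0 => ?_⟩
  · refine ⟨?_⟩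
    rw [hj.comap_apply]
    exact measure_lt_top _ _
  let G : BoundedContinuousFunction (X × OnePoint (EuclideanSpace ℝ (Fin d))) ℝ :=
    BoundedContinuousFunction.ofNormedAddCommGroup
      (fun p => p.2.elim 0 fun a => F (p.1, a)) (continuous_onePoint_elim_zero hF hF0) |M| <| by
      rintro ⟨x, y⟩
      induction y using OnePoint.rec with
      | infty => simp
      | coe a => exact (hM (x, a)).trans (le_abs_self M)
  have hGP : ∀ n, ∫ p, G p ∂(P n).toMeasure = ∫ p, F p ∂(μ n) := fun n => hj.integral_map _
  have hGQ : ∫ p, G p ∂Q.toMeasure = ∫ p, F p ∂(Q.toMeasure.comap j) := by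
    calc ∫ p, G p ∂Q.toMeasure = ∫ p in Set.range j, G p ∂Q.toMeasure := by
          refine (setIntegral_eq_integral_of_forall_compl_eq_zero ?_).symm
          rintro ⟨x, y⟩ hy
          induction y using OnePoint.rec with
          | infty => rfl
          | coe a => exact absurd ⟨(x, a), rfl⟩ hy
      _ = ∫ p, F p ∂(Q.toMeasure.comap j) := by
          rw [← hj.map_comap, hj.integral_map]
          rfl
  simpa [Function.comp_def, hGP, hGQ] using hQ G
end
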